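/- arXiv:1902.09624 — 6 statements merged into one kernel-verified Lean document; each statement's English description precedes it below -/
import Mathlib

section
/- Let (K, v) be a discretely valued field with valuation ring O_K, and let f = x⁴ + c₁x³ + c₂x² + c₃x + c₄ ∈ K[x] be a monic separable quartic polynomial. Assume: (i) v(cᵢ) ≥ 0 for i = 1, 2, 3, 4; (ii) v(cᵢ) < i for some i ∈ {1,2,3,4} (i.e. λ(f) < 1); and (iii) if v(cᵢ) = 0 for some i (i.e. λ(f) = 0), then there is no a ∈ O_K such that every coefficient of f(x + a) − x⁴ has strictly positive valuation (i.e. the image of f in k[x] is not the fourth power of a monic linear polynomial). Then for all α, β ∈ K with α ≠ 0 such that the polynomial g(x) = α⁻⁴·f(α·x + β) has all of its coefficients in O_K, one has v(α) ≤ 0. (Since the discriminant satisfies v(Δ(g)) = v(Δ(f)) − 12·v(α), this says f is a reduced quartic: no equivalent integral quartic has smaller discriminant valuation.) -/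
open Polynomial

namespace AddValuation

variable {K : Type*} [Field K] {v : AddValuation K (WithTop ℤ)}

theorem natCast_nonneg (n : ℕ) : 0 ≤ v (n : K) := by
  induction n with
  | zero => simp
  | succ n ih =>
    push_cast
    exact v.map_le_add ih v.map_one.ge

theorem ofNat_nonneg (n : ℕ) [n.AtLeastTwo] : 0 ≤ v (OfNat.ofNat n : K) :=
  natCast_nonneg (v := v) n

theorem le_map_mul {x y : K} {a b : WithTop ℤ} (hx : a ≤ v x) (hy : b ≤ v y) :
    a + b ≤ v (x * y) := by
  rw [v.map_mul]
  exact add_le_add hx hy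

theorem le_map_mul_of_nonneg {x y : K} {a : WithTop ℤ} (hx : 0 ≤ v x) (hy : a ≤ v y) :
    a ≤ v (x * y) := by
  simpa using le_map_mul hx hy

theorem one_le_map_iff {x : K} : 1 ≤ v x ↔ 0 < v x := by
  cases v x with
  | top => simp
  | coe n => norm_cast

/-- A root modulo the valuation ring of an integral monic quartic is integral. -/
theorem nonneg_of_quartic_nonneg {c₁ c₂ c₃ c₄ β : K} (h₁ : 0 ≤ v c₁) (h₂ : 0 ≤ v c₂)
    (h₃ : 0 ≤ v c₃) (h₄ : 0 ≤ v c₄)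
    (h : 0 ≤ v (β ^ 4 + c₁ * β ^ 3 + c₂ * β ^ 2 + c₃ * β + c₄)) : 0 ≤ v β := by
  by_contra! hβ
  have hβ0 : β ≠ 0 := by
    rintro rfl
    simp at hβ
  have hsum : v β + v β⁻¹ = 0 := by
    rw [← v.map_mul, mul_inv_cancel₀ hβ0, v.map_one]
  have hγ : 0 < v β⁻¹ := by
    by_contra! hγ
    exact ((add_le_of_nonpos_right hγ).trans_lt hβ).ne hsum
  have hnn (x y : K) (hx : 0 ≤ v x) (hy : 0 ≤ v y) : 0 ≤ v (x * y) :=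
    le_map_mul_of_nonneg hx hy
  have hp (n : ℕ) : 0 ≤ v (β⁻¹ ^ n) := by
    rw [v.map_pow]
    exact nsmul_nonneg hγ.le n
  set d := β ^ 4 + c₁ * β ^ 3 + c₂ * β ^ 2 + c₃ * β + c₄ with hd
  have hone : (d * β⁻¹ ^ 3 - c₁ - c₂ * β⁻¹ - c₃ * β⁻¹ ^ 2 - c₄ * β⁻¹ ^ 3) * β⁻¹ = 1 := by
    rw [hd]
    field_simp
    ring
  have hpos := le_map_mul_of_nonneg (v := v) (x := d * β⁻¹ ^ 3 - c₁ - c₂ * β⁻¹ -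
    c₃ * β⁻¹ ^ 2 - c₄ * β⁻¹ ^ 3)
    (v.map_le_sub (v.map_le_sub (v.map_le_sub (v.map_le_sub (hnn _ _ h (hp 3)) h₁)
      (hnn _ _ h₂ hγ.le)) (hnn _ _ h₃ (hp 2))) (hnn _ _ h₄ (hp 3))) (one_le_map_iff.2 hγ)
  rw [hone, one_le_map_iff, v.map_one] at hpos
  exact hpos.false

/-- A root modulo the maximal ideal of an integral quartic congruent to `x⁴` lies in the
maximal ideal. -/
theorem pos_of_quartic_pos {c₁ c₂ c₃ c₄ β : K} (h₁ : 0 < v c₁) (h₂ : 0 < v c₂)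
    (h₃ : 0 < v c₃) (h₄ : 0 < v c₄) (hβ : 0 ≤ v β)
    (h : 0 < v (β ^ 4 + c₁ * β ^ 3 + c₂ * β ^ 2 + c₃ * β + c₄)) : 0 < v β := by
  rw [← one_le_map_iff] at h₁ h₂ h₃ h₄ h
  have hp (n : ℕ) : 0 ≤ v (β ^ n) := by
    rw [v.map_pow]
    exact nsmul_nonneg hβ n
  have hm (x y : K) (hx : 1 ≤ v x) (hy : 0 ≤ v y) : 1 ≤ v (x * y) := by
    rw [mul_comm]
    exact le_map_mul_of_nonneg hy hx
  have h4 := v.map_le_sub (v.map_le_sub (v.map_le_sub (v.map_le_sub h (hm _ _ h₁ (hp 3)))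
    (hm _ _ h₂ (hp 2))) (hm _ _ h₃ hβ)) h₄
  rw [show β ^ 4 + c₁ * β ^ 3 + c₂ * β ^ 2 + c₃ * β + c₄ - c₁ * β ^ 3 - c₂ * β ^ 2 - c₃ * β - c₄
    = β ^ 4 by ring, one_le_map_iff, v.map_pow] at h4
  by_contra! h0
  exact absurd h4 (nsmul_nonpos h0 4).not_gt

/-- If the Taylor coefficients at a point of the maximal ideal of a monic quartic have valuation
at least `1, 2, 3, 4`, then so do its coefficients. -/
theorem le_coeffs_of_le_taylor {c₁ c₂ c₃ c₄ β : K} (hβ : 1 ≤ v β)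
    (h₁ : 1 ≤ v (4 * β + c₁))
    (h₂ : 2 ≤ v (6 * β ^ 2 + 3 * c₁ * β + c₂))
    (h₃ : 3 ≤ v (4 * β ^ 3 + 3 * c₁ * β ^ 2 + 2 * c₂ * β + c₃))
    (h₄ : 4 ≤ v (β ^ 4 + c₁ * β ^ 3 + c₂ * β ^ 2 + c₃ * β + c₄)) :
    1 ≤ v c₁ ∧ 2 ≤ v c₂ ∧ 3 ≤ v c₃ ∧ 4 ≤ v c₄ := by
  have hβ2 : 2 ≤ v (β ^ 2) := by
    simpa [pow_two, one_add_one_eq_two] using le_map_mul hβ hβ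
  have hβ3 : 3 ≤ v (β ^ 3) := by
    simpa [pow_succ, two_add_one_eq_three] using le_map_mul hβ2 hβ
  have hβ4 : 4 ≤ v (β ^ 4) := by
    have := le_map_mul hβ3 hβ
    rwa [three_add_one_eq_four, ← pow_succ] at this
  have h1 : 1 ≤ v c₁ := by
    have := v.map_le_sub h₁ (le_map_mul_of_nonneg (ofNat_nonneg 4) hβ)
    rwa [add_sub_cancel_left] at this
  have h2 : 2 ≤ v c₂ := by
    have hc := le_map_mul_of_nonneg (ofNat_nonneg 3) (le_map_mul h1 hβ)
    rw [one_add_one_eq_two] at hc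
    convert v.map_le_sub (v.map_le_sub h₂ (le_map_mul_of_nonneg (ofNat_nonneg 6) hβ2)) hc using 2
    ring
  have h3 : 3 ≤ v c₃ := by
    have hc := le_map_mul_of_nonneg (ofNat_nonneg 3) (le_map_mul h1 hβ2)
    have hc' := le_map_mul_of_nonneg (ofNat_nonneg 2) (le_map_mul h2 hβ)
    rw [add_comm, two_add_one_eq_three] at hc
    rw [two_add_one_eq_three] at hc'
    convert v.map_le_sub (v.map_le_sub (v.map_le_sub h₃
      (le_map_mul_of_nonneg (ofNat_nonneg 4) hβ3)) hc) hc' using 2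
    ring
  refine ⟨h1, h2, h3, ?_⟩
  have hc := le_map_mul h1 hβ3
  have hc' := le_map_mul h2 hβ2
  have hc'' := le_map_mul h3 hβ
  rw [add_comm, three_add_one_eq_four] at hc
  rw [two_add_two_eq_four] at hc'
  rw [three_add_one_eq_four] at hc''
  convert v.map_le_sub (v.map_le_sub (v.map_le_sub (v.map_le_sub h₄ hβ4) hc) hc') hc'' using 2
  ring

end AddValuation

open AddValuation in
/-- A monic separable quartic `f = x⁴ + c₁x³ + c₂x² + c₃x + c₄` over a discretely valued
field `(K, v)` satisfying the explicit conditions (i) integrality, (ii) `λ(f) < 1`, and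
(iii) if `λ(f) = 0` then the reduction of `f` is not a fourth power of a monic linear
polynomial, is reduced: every equivalent integral quartic `α⁻⁴·f(αx + β)` has `v(α) ≤ 0`. -/
theorem reduced_quartic_of_conditions
    {K : Type*} [Field K] (v : AddValuation K (WithTop ℤ))
    (hsurj : ∀ n : ℤ, ∃ x : K, v x = (n : WithTop ℤ))
    (c₁ c₂ c₃ c₄ : K) (f : K[X])
    (hf : f = X ^ 4 + C c₁ * X ^ 3 + C c₂ * X ^ 2 + C c₃ * X + C c₄)
    (hsep : f.Separable)
    (hint : 0 ≤ v c₁ ∧ 0 ≤ v c₂ ∧ 0 ≤ v c₃ ∧ 0 ≤ v c₄)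
    (hlam : v c₁ < 1 ∨ v c₂ < 2 ∨ v c₃ < 3 ∨ v c₄ < 4)
    (hred : (v c₁ = 0 ∨ v c₂ = 0 ∨ v c₃ = 0 ∨ v c₄ = 0) →
      ¬ ∃ a : K, 0 ≤ v a ∧ ∀ n : ℕ, 0 < v ((f.comp (X + C a) - X ^ 4).coeff n)) :
    ∀ α β : K, α ≠ 0 →
      (∀ n : ℕ, 0 ≤ v ((C (α⁻¹ ^ 4) * f.comp (C α * X + C β)).coeff n)) →
      v α ≤ 0 := by
  intro α β hα hg
  by_contra! hpos
  obtain ⟨h₁, h₂, h₃, h₄⟩ := hint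
  rw [← one_le_map_iff] at hpos
  set d₁ := 4 * β + c₁ with hd₁
  set d₂ := 6 * β ^ 2 + 3 * c₁ * β + c₂ with hd₂
  set d₃ := 4 * β ^ 3 + 3 * c₁ * β ^ 2 + 2 * c₂ * β + c₃ with hd₃
  set d₄ := β ^ 4 + c₁ * β ^ 3 + c₂ * β ^ 2 + c₃ * β + c₄ with hd₄
  have hcomp (a : K) : f.comp (C a * X + C β) = C (a ^ 4) * X ^ 4 + C (a ^ 3 * d₁) * X ^ 3 +
      C (a ^ 2 * d₂) * X ^ 2 + C (a * d₃) * X + C d₄ := by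
    have hC (n : ℕ) [n.AtLeastTwo] : C (OfNat.ofNat n : K) = (OfNat.ofNat n : K[X]) := rfl
    simp only [hf, hd₁, hd₂, hd₃, hd₄, add_comp, mul_comp, pow_comp, X_comp, C_comp, C_add, C_mul,
      C_pow, hC]
    ring
  simp only [hcomp, coeff_C_mul, coeff_add, coeff_X_pow, coeff_X, coeff_C] at hg
  have hα2 : 2 ≤ v (α ^ 2) := by
    simpa [pow_two, one_add_one_eq_two] using le_map_mul hpos hpos
  have hα3 : 3 ≤ v (α ^ 3) := by
    simpa [pow_succ, two_add_one_eq_three] using le_map_mul hα2 hpos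
  have hα4 : 4 ≤ v (α ^ 4) := by
    have := le_map_mul hα3 hpos
    rwa [three_add_one_eq_four, ← pow_succ] at this
  have e₁ : 1 ≤ v d₁ := by
    convert le_map_mul_of_nonneg (hg 3) hpos using 2
    simp [field]
  have e₂ : 2 ≤ v d₂ := by
    convert le_map_mul_of_nonneg (hg 2) hα2 using 2
    simp [field]
  have e₃ : 3 ≤ v d₃ := by
    convert le_map_mul_of_nonneg (hg 1) hα3 using 2
    simp [field]
  have e₄ : 4 ≤ v d₄ := by
    convert le_map_mul_of_nonneg (hg 0) hα4 using 2
    simp [field]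
  have p₁ : 0 < v d₁ := lt_of_lt_of_le (by decide) e₁
  have p₂ : 0 < v d₂ := lt_of_lt_of_le (by decide) e₂
  have p₃ : 0 < v d₃ := lt_of_lt_of_le (by decide) e₃
  have p₄ : 0 < v d₄ := lt_of_lt_of_le (by decide) e₄
  have hβ : 0 ≤ v β := nonneg_of_quartic_nonneg h₁ h₂ h₃ h₄ p₄.le
  by_cases hz : v c₁ = 0 ∨ v c₂ = 0 ∨ v c₃ = 0 ∨ v c₄ = 0
  · refine hred hz ⟨β, hβ, fun n => ?_⟩
    have hc := hcomp 1
    simp only [C_1, one_mul, one_pow] at hc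
    rw [hc]
    match n with
    | 0 => simpa [coeff_X, coeff_C, coeff_X_pow] using p₄
    | 1 => simpa [coeff_X, coeff_C, coeff_X_pow] using p₃
    | 2 => simpa [coeff_X, coeff_C, coeff_X_pow] using p₂
    | 3 => simpa [coeff_X, coeff_C, coeff_X_pow] using p₁
    | n + 4 => simp [coeff_X_pow]
  · push Not at hz
    obtain ⟨z₁, z₂, z₃, z₄⟩ := hz
    have hβ1 := pos_of_quartic_pos (h₁.lt_of_ne' z₁) (h₂.lt_of_ne' z₂) (h₃.lt_of_ne' z₃)
      (h₄.lt_of_ne' z₄) hβ p₄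
    obtain ⟨k₁, k₂, k₃, k₄⟩ := le_coeffs_of_le_taylor (one_le_map_iff.2 hβ1) e₁ e₂ e₃ e₄
    rcases hlam with h | h | h | h
    exacts [h.not_ge k₁, h.not_ge k₂, h.not_ge k₃, h.not_ge k₄]
end

section
/- Let F be a field (or more generally an integral domain), let b, c ∈ F, and suppose the special polynomial g(y) = y⁴ + 6b·y² + c·y − 3b² factors over F (or an extension of F) as g = (y − ξ₁)(y − ξ₂)(y − ξ₃)(y − ξ₄). Then the discriminant of g satisfies ∏_{1 ≤ i < j ≤ 4} (ξᵢ − ξⱼ)² = −27·(64b³ + c²)². In particular, g is separable if and only if 64b³ + c² ≠ 0 (when char F ≠ 3). -/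
open Polynomial

/-- The discriminant of the depressed quartic `y⁴ + p·y² + q·y + r` in terms of its roots. -/
theorem discriminant_depressed_quartic {R : Type*} [CommRing R] {p q r x₁ x₂ x₃ x₄ : R}
    (h₁ : x₁ + x₂ + x₃ + x₄ = 0)
    (h₂ : x₁ * x₂ + x₁ * x₃ + x₁ * x₄ + x₂ * x₃ + x₂ * x₄ + x₃ * x₄ = p)
    (h₃ : x₁ * x₂ * x₃ + x₁ * x₂ * x₄ + x₁ * x₃ * x₄ + x₂ * x₃ * x₄ = -q)
    (h₄ : x₁ * x₂ * x₃ * x₄ = r) :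
    ((x₁ - x₂) * (x₁ - x₃) * (x₁ - x₄) * (x₂ - x₃) * (x₂ - x₄) * (x₃ - x₄)) ^ 2
      = 16 * p ^ 4 * r - 4 * p ^ 3 * q ^ 2 - 128 * p ^ 2 * r ^ 2 + 144 * p * q ^ 2 * r
        - 27 * q ^ 4 + 256 * r ^ 3 := by
  obtain rfl : x₄ = -(x₁ + x₂ + x₃) := by linear_combination h₁
  obtain rfl := neg_eq_iff_eq_neg.mp h₃.symm
  subst h₂ h₄
  ring

/-- Vieta's formulas for a monic quartic. -/
theorem vieta_quartic {R : Type*} [CommRing R] {p q r x₁ x₂ x₃ x₄ : R}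
    (h : (X - C x₁) * (X - C x₂) * (X - C x₃) * (X - C x₄)
      = X ^ 4 + C p * X ^ 2 + C q * X - C r) :
    x₁ + x₂ + x₃ + x₄ = 0 ∧
    x₁ * x₂ + x₁ * x₃ + x₁ * x₄ + x₂ * x₃ + x₂ * x₄ + x₃ * x₄ = p ∧
    x₁ * x₂ * x₃ + x₁ * x₂ * x₄ + x₁ * x₃ * x₄ + x₂ * x₃ * x₄ = -q ∧
    x₁ * x₂ * x₃ * x₄ = -r := by
  have hexp : (X - C x₁) * (X - C x₂) * (X - C x₃) * (X - C x₄) =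
      X ^ 4 - C (x₁ + x₂ + x₃ + x₄) * X ^ 3
        + C (x₁ * x₂ + x₁ * x₃ + x₁ * x₄ + x₂ * x₃ + x₂ * x₄ + x₃ * x₄) * X ^ 2
        - C (x₁ * x₂ * x₃ + x₁ * x₂ * x₄ + x₁ * x₃ * x₄ + x₂ * x₃ * x₄) * X
        + C (x₁ * x₂ * x₃ * x₄) := by
    simp only [map_add, map_mul]
    ring
  rw [hexp] at h
  have coeff_eq (n : ℕ) := congrArg (coeff · n) h
  simp only [coeff_add, coeff_sub, coeff_C_mul, coeff_X_pow, coeff_X, coeff_C] at coeff_eq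
  have h₀ := coeff_eq 0
  have h₁ := coeff_eq 1
  have h₂ := coeff_eq 2
  have h₃ := coeff_eq 3
  norm_num at h₀ h₁ h₂ h₃
  refine ⟨?_, ?_, ?_, ?_⟩
  · linear_combination -h₃
  · linear_combination h₂
  · linear_combination -h₁
  · linear_combination h₀

/-- The discriminant of the special polynomial `g(y) = y⁴ + 6b·y² + c·y − 3b²`:
if `g` factors as `(y − ξ₁)(y − ξ₂)(y − ξ₃)(y − ξ₄)` over an integral domain, then
`∏_{i<j} (ξᵢ − ξⱼ)² = −27·(64b³ + c²)²`.  In particular (when `char F ≠ 3`) the roots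
are pairwise distinct if and only if `64b³ + c² ≠ 0`. -/
theorem discriminant_special_polynomial
    {F : Type*} [CommRing F] [IsDomain F] (b c : F) (ξ₁ ξ₂ ξ₃ ξ₄ : F)
    (hfac : (X - C ξ₁) * (X - C ξ₂) * (X - C ξ₃) * (X - C ξ₄)
      = X ^ 4 + C (6 * b) * X ^ 2 + C c * X - C (3 * b ^ 2)) :
    ((ξ₁ - ξ₂) * (ξ₁ - ξ₃) * (ξ₁ - ξ₄) * (ξ₂ - ξ₃) * (ξ₂ - ξ₄) * (ξ₃ - ξ₄)) ^ 2
        = -27 * (64 * b ^ 3 + c ^ 2) ^ 2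
    ∧ ((3 : F) ≠ 0 →
        (64 * b ^ 3 + c ^ 2 ≠ 0 ↔
          (ξ₁ ≠ ξ₂ ∧ ξ₁ ≠ ξ₃ ∧ ξ₁ ≠ ξ₄ ∧ ξ₂ ≠ ξ₃ ∧ ξ₂ ≠ ξ₄ ∧ ξ₃ ≠ ξ₄))) := by
  obtain ⟨h₁, h₂, h₃, h₄⟩ := vieta_quartic hfac
  have hdisc : ((ξ₁ - ξ₂) * (ξ₁ - ξ₃) * (ξ₁ - ξ₄) * (ξ₂ - ξ₃) * (ξ₂ - ξ₄) * (ξ₃ - ξ₄)) ^ 2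
      = -27 * (64 * b ^ 3 + c ^ 2) ^ 2 := by
    rw [discriminant_depressed_quartic h₁ h₂ h₃ h₄]
    ring
  refine ⟨hdisc, fun h3 => ?_⟩
  have h27 : (-27 : F) ≠ 0 := by
    rw [show (-27 : F) = -3 ^ 3 by norm_num]
    exact neg_ne_zero.mpr (pow_ne_zero 3 h3)
  calc 64 * b ^ 3 + c ^ 2 ≠ 0
      ↔ -27 * (64 * b ^ 3 + c ^ 2) ^ 2 ≠ 0 := by simp only [ne_eq, mul_eq_zero, h27, false_or,
        pow_eq_zero_iff two_ne_zero]
    _ ↔ _ := by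
      rw [← hdisc]
      simp only [ne_eq, pow_eq_zero_iff two_ne_zero, mul_eq_zero, sub_eq_zero, not_or, and_assoc]
end

section
/- Let K be an algebraically closed field with char(K) ≠ 2, 3, let b, c, d ∈ K, and suppose g(y) = y⁴ + b·y² + c·y + d is separable with (distinct) roots ξ₁, ξ₂, ξ₃, ξ₄ ∈ K. Let λ = ((ξ₃ − ξ₁)(ξ₄ − ξ₂)) / ((ξ₃ − ξ₂)(ξ₄ − ξ₁)) be the cross-ratio of the four roots. Then λ² − λ + 1 = 0 if and only if b² + 12·d = 0. (Since the polynomial λ² − λ + 1 is invariant under the substitutions λ ↦ 1 − λ and λ ↦ 1/λ, the condition does not depend on the ordering of the roots.) -/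
open Polynomial

/-- The numerator of `λ² - λ + 1`, for `λ` the cross-ratio of the roots of a monic quartic, is the
invariant `e₂² - 3e₁e₃ + 12e₄` of the quartic. -/
theorem cross_ratio_quadratic_eq_quartic_invariant {R : Type*} [CommRing R] (x y z w : R) :
    ((z - x) * (w - y)) ^ 2 - (z - x) * (w - y) * ((z - y) * (w - x))
        + ((z - y) * (w - x)) ^ 2
      = (x * y + x * z + x * w + y * z + y * w + z * w) ^ 2
        - 3 * (x + y + z + w) * (x * y * z + x * y * w + x * z * w + y * z * w)
        + 12 * (x * y * z * w) := by
  ring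

/-- The expansion of a monic quartic in terms of the elementary symmetric functions of its roots. -/
theorem quartic_eq_sum_esymm {R : Type*} [CommRing R] (x y z w : R) :
    (X - C x) * (X - C y) * (X - C z) * (X - C w)
      = X ^ 4 - C (x + y + z + w) * X ^ 3
        + C (x * y + x * z + x * w + y * z + y * w + z * w) * X ^ 2
        - C (x * y * z + x * y * w + x * z * w + y * z * w) * X + C (x * y * z * w) := by
  simp only [C_add, C_mul]
  ring

/-- Let `K` be algebraically closed with `char K ≠ 2, 3` and let
`g = y⁴ + b·y² + c·y + d` be separable with distinct roots `ξ₁, ξ₂, ξ₃, ξ₄ ∈ K`.  With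
`λ` the cross-ratio of the four roots, one has `λ² − λ + 1 = 0` if and only if
`b² + 12d = 0`. -/
theorem cross_ratio_equianharmonic_iff
    {K : Type*} [Field K] [IsAlgClosed K] (h2 : (2 : K) ≠ 0) (h3 : (3 : K) ≠ 0)
    (b c d : K) (ξ₁ ξ₂ ξ₃ ξ₄ : K)
    (hfac : (X - C ξ₁) * (X - C ξ₂) * (X - C ξ₃) * (X - C ξ₄)
      = X ^ 4 + C b * X ^ 2 + C c * X + C d)
    (hdist : ξ₁ ≠ ξ₂ ∧ ξ₁ ≠ ξ₃ ∧ ξ₁ ≠ ξ₄ ∧ ξ₂ ≠ ξ₃ ∧ ξ₂ ≠ ξ₄ ∧ ξ₃ ≠ ξ₄) :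
    (((ξ₃ - ξ₁) * (ξ₄ - ξ₂)) / ((ξ₃ - ξ₂) * (ξ₄ - ξ₁))) ^ 2
        - ((ξ₃ - ξ₁) * (ξ₄ - ξ₂)) / ((ξ₃ - ξ₂) * (ξ₄ - ξ₁)) + 1 = 0
      ↔ b ^ 2 + 12 * d = 0 := by
  obtain ⟨-, -, h14, h23, -, -⟩ := hdist
  rw [quartic_eq_sum_esymm] at hfac
  have he₁ := congrArg (coeff · 3) hfac
  have he₂ := congrArg (coeff · 2) hfac
  have he₄ := congrArg (coeff · 0) hfac
  simp only [coeff_add, coeff_sub, coeff_C_mul, coeff_X_pow, coeff_X, coeff_C] at he₁ he₂ he₄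
  norm_num only [mul_one, mul_zero, if_true, if_false, add_zero, zero_add, sub_zero, zero_sub,
    neg_eq_zero] at he₁ he₂ he₄
  have hD : (ξ₃ - ξ₂) * (ξ₄ - ξ₁) ≠ 0 :=
    mul_ne_zero (sub_ne_zero.mpr h23.symm) (sub_ne_zero.mpr h14.symm)
  have key := cross_ratio_quadratic_eq_quartic_invariant ξ₁ ξ₂ ξ₃ ξ₄
  rw [he₁, he₂, he₄, mul_zero, zero_mul, sub_zero] at key
  generalize (ξ₃ - ξ₂) * (ξ₄ - ξ₁) = D at hD key ⊢
  generalize (ξ₃ - ξ₁) * (ξ₄ - ξ₂) = N at key ⊢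
  have hquot : (N / D) ^ 2 - N / D + 1 = (N ^ 2 - N * D + D ^ 2) / D ^ 2 := by
    field_simp
  rw [hquot, key, div_eq_zero_iff, or_iff_left (pow_ne_zero 2 hD)]
end

section
/- Let K be a field with char(K) ≠ 2, 3, let b, c ∈ K with 64b³ + c² ≠ 0, and let g(y) = y⁴ + 6b·y² + c·y − 3b² ∈ K[y] (a separable special polynomial). Let L/K be a finite Galois extension containing a splitting field of g and a primitive third root of unity ζ. Then for every γ ∈ Gal(L/K), the permutation that γ induces on the four roots of g in L is odd (has sign −1) if and only if γ(ζ) = ζ² (equivalently, γ(ζ) ≠ ζ). -/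
open Polynomial

/-- The square of the Vandermonde determinant of the roots of a depressed quartic
`y⁴ + p·y² + q·y + r` is its discriminant. -/
lemma det_vandermonde_sq_of_depressed_quartic {R : Type*} [CommRing R] (p q r : R)
    (x : Fin 4 → R)
    (h : X ^ 4 + C p * X ^ 2 + C q * X + C r = ∏ i : Fin 4, (X - C (x i))) :
    (Matrix.vandermonde x).det ^ 2 =
      16 * p ^ 4 * r - 4 * p ^ 3 * q ^ 2 - 128 * p ^ 2 * r ^ 2 + 144 * p * q ^ 2 * r
        - 27 * q ^ 4 + 256 * r ^ 3 := by
  have expand : ∏ i : Fin 4, (X - C (x i)) =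
      X ^ 4 + C (-(x 0 + x 1 + x 2 + x 3)) * X ^ 3
        + C (x 0 * x 1 + x 0 * x 2 + x 0 * x 3 + x 1 * x 2 + x 1 * x 3 + x 2 * x 3) * X ^ 2
        + C (-(x 0 * x 1 * x 2 + x 0 * x 1 * x 3 + x 0 * x 2 * x 3 + x 1 * x 2 * x 3)) * X
        + C (x 0 * x 1 * x 2 * x 3) := by
    simp only [Fin.prod_univ_four, map_add, map_mul, map_neg]
    ring
  rw [expand] at h
  have e0 := congrArg (coeff · 0) h
  have e1 := congrArg (coeff · 1) h
  have e2 := congrArg (coeff · 2) h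
  have e3 := congrArg (coeff · 3) h
  simp [coeff_X, coeff_X_pow, coeff_C, -map_add, -map_mul, -map_neg] at e0 e1 e2 e3
  have hx : x 3 = -(x 0 + x 1 + x 2) := by linear_combination e3
  have hdet : (Matrix.vandermonde x).det =
      (x 1 - x 0) * (x 2 - x 0) * (x 3 - x 0) * ((x 2 - x 1) * (x 3 - x 1)) * (x 3 - x 2) := by
    simp [Matrix.det_succ_row_zero, Fin.sum_univ_succ, Matrix.vandermonde_apply, Fin.succAbove]
    ring
  rw [hdet, e0, e1, e2, hx]
  ring

/-- A ring homomorphism permuting the entries of `x` multiplies the Vandermonde determinant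
of `x` by the sign of the permutation. -/
lemma map_det_vandermonde_of_perm {R : Type*} [CommRing R] {n : ℕ} (f : R →+* R)
    (x : Fin n → R) (σ : Equiv.Perm (Fin n)) (h : ∀ i, f (x i) = x (σ i)) :
    f (Matrix.vandermonde x).det = (Equiv.Perm.sign σ : ℤ) * (Matrix.vandermonde x).det := by
  rw [← Matrix.det_permute, RingHom.map_det]
  congr 1
  ext i j
  simp [Matrix.vandermonde_apply, h]

/-- Let `K` have characteristic `≠ 2, 3`, let `g = y⁴ + 6b·y² + c·y − 3b²` be a separable
special polynomial (`64b³ + c² ≠ 0`), and let `L/K` be a finite Galois extension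
containing a splitting field of `g` and a primitive third root of unity `ζ`.  Then
`γ ∈ Gal(L/K)` induces an odd permutation of the four roots of `g` if and only if
`γ(ζ) = ζ²`. -/
theorem odd_permutation_iff_conjugates_zeta
    {K L : Type*} [Field K] [Field L] [Algebra K L] [FiniteDimensional K L] [IsGalois K L]
    (h2 : (2 : K) ≠ 0) (h3 : (3 : K) ≠ 0)
    (b c : K) (hbc : 64 * b ^ 3 + c ^ 2 ≠ 0)
    (ξ : Fin 4 → L) (hinj : Function.Injective ξ)
    (hsplit : Polynomial.map (algebraMap K L)
        (X ^ 4 + C (6 * b) * X ^ 2 + C c * X - C (3 * b ^ 2))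
      = ∏ i : Fin 4, (X - C (ξ i)))
    (ζ : L) (hζ : IsPrimitiveRoot ζ 3)
    (γ : L ≃ₐ[K] L) (σ : Equiv.Perm (Fin 4)) (hσ : ∀ i, γ (ξ i) = ξ (σ i)) :
    Equiv.Perm.sign σ = -1 ↔ γ ζ = ζ ^ 2 := by
  have inj := FaithfulSMul.algebraMap_injective K L
  have h2L : (2 : L) ≠ 0 := by
    simpa only [map_ofNat] using (map_ne_zero_iff (algebraMap K L) inj).2 h2
  have h3L : (3 : L) ≠ 0 := by
    simpa only [map_ofNat] using (map_ne_zero_iff (algebraMap K L) inj).2 h3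
  have hζ1 : ζ ≠ 1 := hζ.ne_one (by norm_num)
  have hζ2 : ζ ^ 2 + ζ + 1 = 0 := by
    have h : (ζ - 1) * (ζ ^ 2 + ζ + 1) = 0 := by linear_combination hζ.pow_eq_one
    exact (mul_eq_zero.1 h).resolve_left (sub_ne_zero.2 hζ1)
  have hs : 2 * ζ + 1 ≠ 0 := by
    intro h
    apply h3L
    linear_combination (-(2 * ζ + 1)) * h + 4 * hζ2
  have hV0 : (Matrix.vandermonde ξ).det ≠ 0 := Matrix.det_vandermonde_ne_zero_iff.2 hinj
  have hVsq := det_vandermonde_sq_of_depressed_quartic (6 * algebraMap K L b)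
    (algebraMap K L c) (-(3 * algebraMap K L b ^ 2)) ξ (by
      rw [← hsplit]
      simp [sub_eq_add_neg, map_ofNat (algebraMap K L)])
  have hγV := map_det_vandermonde_of_perm (γ : L →+* L) ξ σ hσ
  set V := (Matrix.vandermonde ξ).det
  obtain ⟨a, ha⟩ : ∃ a : K, V = algebraMap K L a * (2 * ζ + 1) := by
    have h : V ^ 2 = (algebraMap K L (3 * (64 * b ^ 3 + c ^ 2)) * (2 * ζ + 1)) ^ 2 := by
      rw [hVsq]
      simp only [map_mul, map_add, map_pow, map_ofNat]
      linear_combination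
        (-36 * (64 * algebraMap K L b ^ 3 + algebraMap K L c ^ 2) ^ 2) * hζ2
    rcases sq_eq_sq_iff_eq_or_eq_neg.1 h with h | h
    · exact ⟨_, h⟩
    · exact ⟨-(3 * (64 * b ^ 3 + c ^ 2)), by rw [h, map_neg, neg_mul]⟩
  have ha0 : algebraMap K L a ≠ 0 := by
    intro h
    rw [h, zero_mul] at ha
    exact hV0 ha
  have hγs : 2 * γ ζ + 1 = (Equiv.Perm.sign σ : ℤ) * (2 * ζ + 1) := by
    apply mul_left_cancel₀ ha0
    rw [ha] at hγV
    simp only [map_mul, map_add, map_one, map_ofNat, RingHom.coe_coe, AlgEquiv.commutes] at hγV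
    linear_combination hγV
  rcases Int.units_eq_one_or (Equiv.Perm.sign σ) with h | h <;> rw [h] at hγs ⊢
  · have hγζ : γ ζ = ζ := by
      apply mul_left_cancel₀ h2L
      push_cast at hγs
      linear_combination hγs
    refine iff_of_false (by decide) fun h' => hs ?_
    linear_combination hζ2 + h' - hγζ
  · refine iff_of_true rfl (mul_left_cancel₀ h2L ?_)
    push_cast at hγs
    linear_combination hγs - 2 * hζ2
end

section
/- Let K be a field with char(K) ∉ {2, 3}, and let f = x⁴ + c₂x² + c₃x + c₄ and f' = x⁴ + c₂'x² + c₃'x + c₄' be two monic depressed quartics in K[x]. Then the following are equivalent: (1) there exist α, β, γ ∈ K with α ≠ 0 and γ ≠ 0 such that f'(α·x + β) = γ³·f(x) as polynomials in K[x]; (2) there exists ν ∈ K^× such that c₂' = ν⁶·c₂, c₃' = ν⁹·c₃ and c₄' = ν¹²·c₄. (Moreover, in case (1) one necessarily has β = 0, α = ν³ and γ = ν⁴ for such a ν.) -/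
open Polynomial

/-- Expansion of a depressed quartic after the affine substitution `x ↦ αx + β`. -/
theorem depressed_quartic_comp_affine {R : Type*} [CommRing R] (a b c α β : R) :
    (X ^ 4 + C a * X ^ 2 + C b * X + C c).comp (C α * X + C β)
      = C (α ^ 4) * X ^ 4 + C (4 * α ^ 3 * β) * X ^ 3 + C (6 * α ^ 2 * β ^ 2 + a * α ^ 2) * X ^ 2
        + C (4 * α * β ^ 3 + 2 * a * α * β + b * α) * X
        + C (β ^ 4 + a * β ^ 2 + b * β + c) := by
  simp only [add_comp, mul_comp, pow_comp, X_comp, C_comp, C_add, C_mul, C_pow, map_ofNat]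
  ring

/-- Quartics of the form `a₄x⁴ + a₃x³ + a₂x² + a₁x + a₀` are determined by their coefficients. -/
theorem quartic_coeffs_eq {R : Type*} [CommRing R] {a₄ a₃ a₂ a₁ a₀ b₄ b₃ b₂ b₁ b₀ : R}
    (h : C a₄ * X ^ 4 + C a₃ * X ^ 3 + C a₂ * X ^ 2 + C a₁ * X + C a₀
      = C b₄ * X ^ 4 + C b₃ * X ^ 3 + C b₂ * X ^ 2 + C b₁ * X + C b₀) :
    a₄ = b₄ ∧ a₃ = b₃ ∧ a₂ = b₂ ∧ a₁ = b₁ ∧ a₀ = b₀ := by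
  refine ⟨?_, ?_, ?_, ?_, ?_⟩
  · simpa [coeff_X, coeff_C, coeff_X_pow] using congrArg (coeff · 4) h
  · simpa [coeff_X, coeff_C, coeff_X_pow] using congrArg (coeff · 3) h
  · simpa [coeff_X, coeff_C, coeff_X_pow] using congrArg (coeff · 2) h
  · simpa [coeff_X, coeff_C, coeff_X_pow] using congrArg (coeff · 1) h
  · simpa [coeff_X, coeff_C, coeff_X_pow] using congrArg (coeff · 0) h

/-- An affine substitution carrying one depressed quartic to a multiple `γ³` of another is
`x ↦ ν³x` with `γ = ν⁴`. -/
theorem depressed_quartic_substitution_scaling {K : Type*} [Field K] (h2 : (2 : K) ≠ 0)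
    {c₂ c₃ c₄ c₂' c₃' c₄' α β γ : K} (hα : α ≠ 0) (hγ : γ ≠ 0)
    (h : (X ^ 4 + C c₂' * X ^ 2 + C c₃' * X + C c₄').comp (C α * X + C β)
      = C (γ ^ 3) * (X ^ 4 + C c₂ * X ^ 2 + C c₃ * X + C c₄)) :
    β = 0 ∧ ∃ ν : K, ν ≠ 0 ∧ α = ν ^ 3 ∧ γ = ν ^ 4 ∧
      c₂' = ν ^ 6 * c₂ ∧ c₃' = ν ^ 9 * c₃ ∧ c₄' = ν ^ 12 * c₄ := by
  have hexp : C (γ ^ 3) * (X ^ 4 + C c₂ * X ^ 2 + C c₃ * X + C c₄)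
      = C (γ ^ 3) * X ^ 4 + C 0 * X ^ 3 + C (γ ^ 3 * c₂) * X ^ 2 + C (γ ^ 3 * c₃) * X
        + C (γ ^ 3 * c₄) := by
    simp only [C_mul, C_0]
    ring
  rw [depressed_quartic_comp_affine, hexp] at h
  obtain ⟨e₄, e₃, e₂, e₁, e₀⟩ := quartic_coeffs_eq h
  have h4 : (4 : K) ≠ 0 := by
    rw [show (4 : K) = 2 * 2 by norm_num]
    exact mul_ne_zero h2 h2
  have hβ : β = 0 := by simpa [h4, hα] using e₃
  subst hβ
  have hν₃ : α = (γ / α) ^ 3 := by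
    field_simp
    linear_combination e₄
  have hν₄ : γ = (γ / α) ^ 4 := by
    rw [pow_succ, ← hν₃]
    field_simp
  refine ⟨rfl, γ / α, div_ne_zero hγ hα, hν₃, hν₄, ?_, ?_, ?_⟩
  · rw [show (γ / α) ^ 6 = ((γ / α) ^ 3) ^ 2 by ring, ← hν₃]
    apply mul_left_cancel₀ (pow_ne_zero 2 hα)
    linear_combination e₂ - c₂ * e₄
  · rw [show (γ / α) ^ 9 = ((γ / α) ^ 3) ^ 3 by ring, ← hν₃]
    apply mul_left_cancel₀ hα
    linear_combination e₁ - c₃ * e₄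
  · rw [show (γ / α) ^ 12 = ((γ / α) ^ 3) ^ 4 by ring, ← hν₃]
    linear_combination e₀ - c₄ * e₄

/-- Two monic depressed quartics `f = x⁴ + c₂x² + c₃x + c₄` and
`f' = x⁴ + c₂'x² + c₃'x + c₄'` over a field of characteristic `≠ 2, 3` are related by a
substitution `f'(αx + β) = γ³·f(x)` (with `α, γ ≠ 0`) if and only if there is `ν ∈ K^×`
with `c₂' = ν⁶c₂`, `c₃' = ν⁹c₃`, `c₄' = ν¹²c₄`; moreover any such substitution has
`β = 0`, `α = ν³`, `γ = ν⁴`. -/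
theorem depressed_quartic_equivalence_weighted_invariants
    {K : Type*} [Field K] (h2 : (2 : K) ≠ 0) (h3 : (3 : K) ≠ 0)
    (c₂ c₃ c₄ c₂' c₃' c₄' : K) :
    ((∃ α β γ : K, α ≠ 0 ∧ γ ≠ 0 ∧
        (X ^ 4 + C c₂' * X ^ 2 + C c₃' * X + C c₄').comp (C α * X + C β)
          = C (γ ^ 3) * (X ^ 4 + C c₂ * X ^ 2 + C c₃ * X + C c₄))
      ↔ (∃ ν : K, ν ≠ 0 ∧ c₂' = ν ^ 6 * c₂ ∧ c₃' = ν ^ 9 * c₃ ∧ c₄' = ν ^ 12 * c₄))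
    ∧ (∀ α β γ : K, α ≠ 0 → γ ≠ 0 →
        (X ^ 4 + C c₂' * X ^ 2 + C c₃' * X + C c₄').comp (C α * X + C β)
          = C (γ ^ 3) * (X ^ 4 + C c₂ * X ^ 2 + C c₃ * X + C c₄) →
        β = 0 ∧ ∃ ν : K, ν ≠ 0 ∧ α = ν ^ 3 ∧ γ = ν ^ 4 ∧
          c₂' = ν ^ 6 * c₂ ∧ c₃' = ν ^ 9 * c₃ ∧ c₄' = ν ^ 12 * c₄) := by
  refine ⟨⟨?_, ?_⟩, fun α β γ hα hγ h => depressed_quartic_substitution_scaling h2 hα hγ h⟩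
  · rintro ⟨α, β, γ, hα, hγ, h⟩
    obtain ⟨-, ν, hν, -, -, hc⟩ := depressed_quartic_substitution_scaling h2 hα hγ h
    exact ⟨ν, hν, hc⟩
  · rintro ⟨ν, hν, rfl, rfl, rfl⟩
    refine ⟨ν ^ 3, 0, ν ^ 4, pow_ne_zero 3 hν, pow_ne_zero 4 hν, ?_⟩
    simp only [add_comp, mul_comp, pow_comp, X_comp, C_comp, C_mul, C_pow, C_0]
    ring
end

section
/- Let K be a field with char(K) ≠ 2, 3 containing an element s with s² = 3. Define ρ(x, y) = (s·x/(y + 1), (2 − y)/(y + 1)) for y ≠ −1. Then ρ maps the set S = {(x, y) ∈ K × K : x⁴ = y³ + 1 and y ≠ −1} into itself: if x⁴ = y³ + 1 and y ≠ −1, then (2 − y)/(y + 1) ≠ −1 and (s·x/(y + 1))⁴ = ((2 − y)/(y + 1))³ + 1. Moreover ρ is an involution of S: applying ρ twice gives back (x, y). -/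
/-- On the standard special Picard curve `x⁴ = y³ + 1` over a field `K` with
`char K ≠ 2, 3` containing `s` with `s² = 3`, the map
`ρ(x, y) = (s·x/(y + 1), (2 − y)/(y + 1))` is a well-defined involution of the set of
affine points with `y ≠ −1`. -/
theorem rho_involution_special_picard
    {K : Type*} [Field K] (h2 : (2 : K) ≠ 0) (h3 : (3 : K) ≠ 0)
    (s : K) (hs : s ^ 2 = 3) :
    ∀ x y : K, x ^ 4 = y ^ 3 + 1 → y ≠ -1 →
      (2 - y) / (y + 1) ≠ -1 ∧
      (s * x / (y + 1)) ^ 4 = ((2 - y) / (y + 1)) ^ 3 + 1 ∧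
      s * (s * x / (y + 1)) / ((2 - y) / (y + 1) + 1) = x ∧
      (2 - (2 - y) / (y + 1)) / ((2 - y) / (y + 1) + 1) = y := by
  intro x y hxy hy
  have hd : y + 1 ≠ 0 := fun h => hy (eq_neg_of_add_eq_zero_left h)
  have key : (2 - y) / (y + 1) + 1 = 3 / (y + 1) := by
    field_simp
    ring
  refine ⟨fun h => ?_, ?_, ?_, ?_⟩
  · rw [h, neg_add_cancel] at key
    exact div_ne_zero h3 hd key.symm
  · have hs4 : s ^ 4 = 9 := by linear_combination (s ^ 2 + 3) * hs
    rw [div_pow, div_pow, mul_pow, hs4, hxy]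
    field_simp
    ring
  · rw [key]
    field_simp
    linear_combination x * hs
  · rw [key]
    field_simp
    ring
end
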